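/- For t ∈ ℝ let Λ_t be the positive operator on 𝓗² given by Λ_t(w₁,w₂) = ((t² + GG*)^{1/2}w₁, (t² + G*G)^{1/2}w₂) (invertible since G is invertible), and set Π_t^± = (1/2)(Id ± Λ_t^{-1}V(t)). Then for every t ∈ ℝ: (i) (Π_t^±)* = Π_t^±; (ii) (Π_t^±)² = Π_t^±; (iii) Π_t^+ Π_t^- = Π_t^- Π_t^+ = 0; (iv) Π_t^+ + Π_t^- = Id; (v) V(t)Π_t^± = Π_t^± V(t) = ±Λ_t Π_t^± = ±Π_t^± Λ_t. -/

import Mathlib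

open ContinuousLinearMap Complex Filter Topology
open scoped InnerProductSpace

noncomputable section

variable {H : Type*} [NormedAddCommGroup H] [InnerProductSpace ℂ H] [CompleteSpace H]

/-- Functional calculus `χ(A)` of a selfadjoint operator `A` for a complex-valued
function `χ : ℝ → ℂ` (defined via the real continuous functional calculus applied to
the real and imaginary parts of `χ`). -/
def fc (χ : ℝ → ℂ) (A : H →L[ℂ] H) : H →L[ℂ] H :=
  cfc (fun x : ℝ => (χ x).re) A + Complex.I • cfc (fun x : ℝ => (χ x).im) A

/-- The commutation assumption: for every continuous `χ : ℝ → ℂ`,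
`χ(GG*)G = Gχ(G*G)` and `χ(G*G)G* = G*χ(GG*)`. -/
def CommHyp (G : H →L[ℂ] H) : Prop :=
  ∀ χ : ℝ → ℂ, Continuous χ →
    (fc χ (G * ContinuousLinearMap.adjoint G)) ∘L G
        = G ∘L (fc χ (ContinuousLinearMap.adjoint G * G)) ∧
    (fc χ (ContinuousLinearMap.adjoint G * G)) ∘L ContinuousLinearMap.adjoint G
        = ContinuousLinearMap.adjoint G ∘L (fc χ (G * ContinuousLinearMap.adjoint G))

/-- The equivalence between `𝓗²` (with its Hilbert space structure) and `𝓗 × 𝓗`. -/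
def eqv : WithLp 2 (H × H) ≃L[ℂ] H × H := WithLp.prodContinuousLinearEquiv 2 ℂ H H

/-- The operator `V(s)(w₁,w₂) = (s·w₁ + Gw₂, G*w₁ − s·w₂)` on `𝓗²`. -/
def Vop (G : H →L[ℂ] H) (s : ℝ) : WithLp 2 (H × H) →L[ℂ] WithLp 2 (H × H) :=
  (eqv (H := H)).symm.toContinuousLinearMap ∘L
    ((((s : ℂ) • ContinuousLinearMap.fst ℂ H H + G ∘L ContinuousLinearMap.snd ℂ H H)).prod
      ((ContinuousLinearMap.adjoint G) ∘L ContinuousLinearMap.fst ℂ H H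
        - (s : ℂ) • ContinuousLinearMap.snd ℂ H H)) ∘L
    (eqv (H := H)).toContinuousLinearMap

/-- `F₁(u) = f₁(‖u₁‖², ‖u₂‖²)`. -/
def F1 (f₁ : ℝ × ℝ → ℝ) (u : WithLp 2 (H × H)) : ℝ := f₁ (‖u.fst‖ ^ 2, ‖u.snd‖ ^ 2)

/-- `F₂(u) = f₂(‖u₁‖², ‖u₂‖²)`. -/
def F2 (f₂ : ℝ × ℝ → ℝ) (u : WithLp 2 (H × H)) : ℝ := f₂ (‖u.fst‖ ^ 2, ‖u.snd‖ ^ 2)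

/-- The nonlinear term `F(u)u = (F₁(u)u₁, F₂(u)u₂)`. -/
def nlt (f₁ f₂ : ℝ × ℝ → ℝ) (u : WithLp 2 (H × H)) : WithLp 2 (H × H) :=
  (WithLp.equiv 2 (H × H)).symm ((F1 f₁ u) • u.fst, (F2 f₂ u) • u.snd)

/-- `u` is a (global, `C¹`) solution of `−i u′(s) = V(s)u(s) + δ F(u(s))u(s)`:
equivalently, `u′(s) = i (V(s)u(s) + δ F(u(s))u(s))` for all `s`. -/
def IsLZSol (G : H →L[ℂ] H) (δ : ℝ) (f₁ f₂ : ℝ × ℝ → ℝ) (u : ℝ → WithLp 2 (H × H)) : Prop :=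
  ∀ s : ℝ, HasDerivAt u (Complex.I • (Vop G s (u s) + δ • nlt f₁ f₂ (u s))) s

/-- `f ∈ C²(ℝ²;ℝ)` with bounded second derivative. -/
def C2Bdd (f : ℝ × ℝ → ℝ) : Prop :=
  ContDiff ℝ 2 f ∧ ∃ C : ℝ, ∀ p : ℝ × ℝ, ‖iteratedFDeriv ℝ 2 f p‖ ≤ C

/-- `θ ∈ C_c^∞(ℝ;ℝ)`, `0 ≤ θ ≤ 1`, `θ = 1` on `(−1/2,1/2)` and `θ = 0` outside `[−1,1]`. -/
def IsCutoff (θ : ℝ → ℝ) : Prop :=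
  ContDiff ℝ (⊤ : ℕ∞) θ ∧ HasCompactSupport θ ∧ (∀ x, 0 ≤ θ x ∧ θ x ≤ 1) ∧
    (∀ x, |x| < 1/2 → θ x = 1) ∧ (∀ x, 1 < |x| → θ x = 0)

/-- The cutoff operator `Θ_R = diag(θ(GG*/R²), θ(G*G/R²))`. -/
def Theta (G : H →L[ℂ] H) (θ : ℝ → ℝ) (R : ℝ) :
    WithLp 2 (H × H) →L[ℂ] WithLp 2 (H × H) :=
  (eqv (H := H)).symm.toContinuousLinearMap ∘L
    ((cfc (fun x : ℝ => θ (x / R ^ 2)) (G * ContinuousLinearMap.adjoint G)).prodMap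
      (cfc (fun x : ℝ => θ (x / R ^ 2)) (ContinuousLinearMap.adjoint G * G))) ∘L
    (eqv (H := H)).toContinuousLinearMap

/-- The phase `φ(s,λ) = s²/2 + (λ/2)·log|s|`. -/
def phase (s lam : ℝ) : ℝ := s ^ 2 / 2 + lam / 2 * Real.log |s|

/-- The unitary operator `e^{iφ(s,GG*)}` on `𝓗`. -/
def ePhaseP (G : H →L[ℂ] H) (s : ℝ) : H →L[ℂ] H :=
  fc (fun lam => Complex.exp (Complex.I * (phase s lam))) (G * ContinuousLinearMap.adjoint G)

/-- The unitary operator `e^{−iφ(s,G*G)}` on `𝓗`. -/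
def ePhaseM (G : H →L[ℂ] H) (s : ℝ) : H →L[ℂ] H :=
  fc (fun lam => Complex.exp (-(Complex.I * (phase s lam))))
    (ContinuousLinearMap.adjoint G * G)

/-- The model asymptotic first component `e^{iδF₁(ω)s + iϕ}·e^{iφ(s,GG*)}ω₁`. -/
def asym1 (G : H →L[ℂ] H) (δ : ℝ) (f₁ : ℝ × ℝ → ℝ) (ω : WithLp 2 (H × H)) (ϕ : ℝ)
    (s : ℝ) : H :=
  Complex.exp (Complex.I * (δ * F1 f₁ ω * s + ϕ)) • (ePhaseP G s ω.fst)

/-- The model asymptotic second component `e^{iδF₂(ω)s − iϕ}·e^{−iφ(s,G*G)}ω₂`. -/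
def asym2 (G : H →L[ℂ] H) (δ : ℝ) (f₂ : ℝ × ℝ → ℝ) (ω : WithLp 2 (H × H)) (ϕ : ℝ)
    (s : ℝ) : H :=
  Complex.exp (Complex.I * (δ * F2 f₂ ω * s - ϕ)) • (ePhaseM G s ω.snd)

/-- `α` is the incoming scattering state (at `s → −∞`) of `u`, with phase shift `ϕ`. -/
def Incoming (G : H →L[ℂ] H) (δ : ℝ) (f₁ f₂ : ℝ × ℝ → ℝ) (α : WithLp 2 (H × H)) (ϕ : ℝ)
    (u : ℝ → WithLp 2 (H × H)) : Prop :=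
  Tendsto (fun s => ‖(u s).fst - asym1 G δ f₁ α ϕ s‖ + ‖(u s).snd - asym2 G δ f₂ α ϕ s‖)
    atBot (𝓝 0)

/-- `ω` is the outgoing scattering state (at `s → +∞`) of `u`, with phase shift `ϕ`. -/
def Outgoing (G : H →L[ℂ] H) (δ : ℝ) (f₁ f₂ : ℝ × ℝ → ℝ) (ω : WithLp 2 (H × H)) (ϕ : ℝ)
    (u : ℝ → WithLp 2 (H × H)) : Prop :=
  Tendsto (fun s => ‖(u s).fst - asym1 G δ f₁ ω ϕ s‖ + ‖(u s).snd - asym2 G δ f₂ ω ϕ s‖)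
    atTop (𝓝 0)

/-- `M(u) = (δ/2)(F₁(u) + F₂(u))`. -/
def Mscal (δ : ℝ) (f₁ f₂ : ℝ × ℝ → ℝ) (u : WithLp 2 (H × H)) : ℝ :=
  δ / 2 * (F1 f₁ u + F2 f₂ u)

/-- `m(u) = (δ/2)(F₁(u) − F₂(u))`. -/
def mscal (δ : ℝ) (f₁ f₂ : ℝ × ℝ → ℝ) (u : WithLp 2 (H × H)) : ℝ :=
  δ / 2 * (F1 f₁ u - F2 f₂ u)

/-- The gauge transform `v(s) = e^{−i∫₀ˢ M(u(τ))dτ}·u(s)`. -/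
def gaugeT (δ : ℝ) (f₁ f₂ : ℝ × ℝ → ℝ) (u : ℝ → WithLp 2 (H × H)) :
    ℝ → WithLp 2 (H × H) :=
  fun s => Complex.exp (-(Complex.I * (∫ τ in (0:ℝ)..s, Mscal δ f₁ f₂ (u τ)))) • u s

/-- `σ(s) = s + m(u(s))`. -/
def sigma (δ : ℝ) (f₁ f₂ : ℝ × ℝ → ℝ) (u : ℝ → WithLp 2 (H × H)) (s : ℝ) : ℝ :=
  s + mscal δ f₁ f₂ (u s)

/-- The operator `Λ_t = diag((t² + GG*)^{1/2}, (t² + G*G)^{1/2})` on `𝓗²`. -/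
def LamOp (G : H →L[ℂ] H) (t : ℝ) : WithLp 2 (H × H) →L[ℂ] WithLp 2 (H × H) :=
  (eqv (H := H)).symm.toContinuousLinearMap ∘L
    ((cfc (fun x : ℝ => Real.sqrt (t ^ 2 + x)) (G * ContinuousLinearMap.adjoint G)).prodMap
      (cfc (fun x : ℝ => Real.sqrt (t ^ 2 + x)) (ContinuousLinearMap.adjoint G * G))) ∘L
    (eqv (H := H)).toContinuousLinearMap

/-- The operator `Λ_t⁻¹ = diag((t² + GG*)^{-1/2}, (t² + G*G)^{-1/2})` on `𝓗²`. -/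
def LamInv (G : H →L[ℂ] H) (t : ℝ) : WithLp 2 (H × H) →L[ℂ] WithLp 2 (H × H) :=
  (eqv (H := H)).symm.toContinuousLinearMap ∘L
    ((cfc (fun x : ℝ => (Real.sqrt (t ^ 2 + x))⁻¹)
        (G * ContinuousLinearMap.adjoint G)).prodMap
      (cfc (fun x : ℝ => (Real.sqrt (t ^ 2 + x))⁻¹)
        (ContinuousLinearMap.adjoint G * G))) ∘L
    (eqv (H := H)).toContinuousLinearMap

/-- The projection `Π_t^+ = (1/2)(Id + Λ_t⁻¹V(t))`. -/
def PiP (G : H →L[ℂ] H) (t : ℝ) : WithLp 2 (H × H) →L[ℂ] WithLp 2 (H × H) :=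
  (2 : ℂ)⁻¹ • (1 + LamInv G t ∘L Vop G t)

/-- The projection `Π_t^- = (1/2)(Id − Λ_t⁻¹V(t))`. -/
def PiM (G : H →L[ℂ] H) (t : ℝ) : WithLp 2 (H × H) →L[ℂ] WithLp 2 (H × H) :=
  (2 : ℂ)⁻¹ • (1 - LamInv G t ∘L Vop G t)

/-- `m̃(x,y) = (δ/2)(f₁(x,y) − f₂(x,y))`. -/
def mtilde (δ : ℝ) (f₁ f₂ : ℝ × ℝ → ℝ) : ℝ × ℝ → ℝ := fun p => δ / 2 * (f₁ p - f₂ p)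

/-- `m̲(s) = (∂₁m̃ − ∂₂m̃)(‖v₁(s)‖², ‖v₂(s)‖²)`. -/
def mbar (δ : ℝ) (f₁ f₂ : ℝ × ℝ → ℝ) (v : ℝ → WithLp 2 (H × H)) (s : ℝ) : ℝ :=
  fderiv ℝ (mtilde δ f₁ f₂) (‖(v s).fst‖ ^ 2, ‖(v s).snd‖ ^ 2) (1, 0) -
    fderiv ℝ (mtilde δ f₁ f₂) (‖(v s).fst‖ ^ 2, ‖(v s).snd‖ ^ 2) (0, 1)


/-- The operator `A(a,b,c,d)(w₁,w₂) = (a(GG*)w₁ + b(GG*)Gw₂, c(G*G)G*w₁ + d(G*G)w₂)`. -/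
def Aop (G : H →L[ℂ] H) (a b c d : ℝ → ℂ) :
    WithLp 2 (H × H) →L[ℂ] WithLp 2 (H × H) :=
  (eqv (H := H)).symm.toContinuousLinearMap ∘L
    (((fc a (G * ContinuousLinearMap.adjoint G)) ∘L ContinuousLinearMap.fst ℂ H H
        + (fc b (G * ContinuousLinearMap.adjoint G)) ∘L G ∘L ContinuousLinearMap.snd ℂ H H).prod
      ((fc c (ContinuousLinearMap.adjoint G * G)) ∘L (ContinuousLinearMap.adjoint G)
          ∘L ContinuousLinearMap.fst ℂ H H
        + (fc d (ContinuousLinearMap.adjoint G * G)) ∘L ContinuousLinearMap.snd ℂ H H)) ∘L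
    (eqv (H := H)).toContinuousLinearMap

/-- The operator `𝒦(w₁,w₂) = (−Gw₂, G*w₁)` on `𝓗²`. -/
def Kcal (G : H →L[ℂ] H) : WithLp 2 (H × H) →L[ℂ] WithLp 2 (H × H) :=
  (eqv (H := H)).symm.toContinuousLinearMap ∘L
    ((-(G ∘L ContinuousLinearMap.snd ℂ H H)).prod
      ((ContinuousLinearMap.adjoint G) ∘L ContinuousLinearMap.fst ℂ H H)) ∘L
    (eqv (H := H)).toContinuousLinearMap


lemma ext_fst_snd {E : Type*} [NormedAddCommGroup E] [InnerProductSpace ℂ E]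
    {S T : WithLp 2 (E × E) →L[ℂ] WithLp 2 (E × E)}
    (h₁ : ∀ w, (S w).fst = (T w).fst) (h₂ : ∀ w, (S w).snd = (T w).snd) : S = T :=
  ContinuousLinearMap.ext fun w => (WithLp.equiv 2 (E × E)).injective (Prod.ext (h₁ w) (h₂ w))

section FunctionalCalculus

variable {A : H →L[ℂ] H} {t : ℝ}

lemma continuous_sqrt_sq_add (t : ℝ) : Continuous fun x : ℝ => Real.sqrt (t ^ 2 + x) := by
  fun_prop

lemma sq_add_pos_of_mem_spectrum (hA : 0 ≤ A) (hu : IsUnit A) {x : ℝ} (hx : x ∈ spectrum ℝ A) :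
    0 < t ^ 2 + x := by
  have h0 : 0 ≤ x := spectrum_nonneg_of_nonneg hA hx
  have h1 : x ≠ 0 := by
    rintro rfl
    exact spectrum.zero_notMem ℝ hu hx
  positivity

lemma cfc_sqrt_sq_add_mul_self (hA : 0 ≤ A) (hu : IsUnit A) :
    cfc (fun x : ℝ => Real.sqrt (t ^ 2 + x)) A * cfc (fun x : ℝ => Real.sqrt (t ^ 2 + x)) A
      = ((t : ℂ) ^ 2) • 1 + A := by
  have hsa : IsSelfAdjoint A := hA.isSelfAdjoint
  rw [← cfc_mul _ _ A (continuous_sqrt_sq_add t).continuousOn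
    (continuous_sqrt_sq_add t).continuousOn]
  have h : Set.EqOn (fun x : ℝ => Real.sqrt (t ^ 2 + x) * Real.sqrt (t ^ 2 + x))
      (fun x => t ^ 2 + x) (spectrum ℝ A) := fun x hx =>
    Real.mul_self_sqrt (sq_add_pos_of_mem_spectrum hA hu hx).le
  rw [cfc_congr h, cfc_const_add _ _ A, cfc_id' ℝ A, Algebra.algebraMap_eq_smul_one]
  congr 1
  ext x
  simp [← Complex.ofReal_pow]

lemma continuousOn_inv_sqrt_sq_add (hA : 0 ≤ A) (hu : IsUnit A) :
    ContinuousOn (fun x : ℝ => (Real.sqrt (t ^ 2 + x))⁻¹) (spectrum ℝ A) :=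
  (continuous_sqrt_sq_add t).continuousOn.inv₀ fun _ hx =>
    (Real.sqrt_pos.2 (sq_add_pos_of_mem_spectrum hA hu hx)).ne'

lemma cfc_sqrt_sq_add_mul_cfc_inv (hA : 0 ≤ A) (hu : IsUnit A) :
    cfc (fun x : ℝ => Real.sqrt (t ^ 2 + x)) A
      * cfc (fun x : ℝ => (Real.sqrt (t ^ 2 + x))⁻¹) A = 1 := by
  have hsa : IsSelfAdjoint A := hA.isSelfAdjoint
  rw [← cfc_mul _ _ A (continuous_sqrt_sq_add t).continuousOn
    (continuousOn_inv_sqrt_sq_add hA hu), ← cfc_one ℝ A]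
  exact cfc_congr fun x hx =>
    mul_inv_cancel₀ (Real.sqrt_pos.2 (sq_add_pos_of_mem_spectrum hA hu hx)).ne'

lemma cfc_inv_mul_cfc_sqrt_sq_add (hA : 0 ≤ A) (hu : IsUnit A) :
    cfc (fun x : ℝ => (Real.sqrt (t ^ 2 + x))⁻¹) A
      * cfc (fun x : ℝ => Real.sqrt (t ^ 2 + x)) A = 1 := by
  rw [← cfc_sqrt_sq_add_mul_cfc_inv (t := t) hA hu]
  exact cfc_commute_cfc _ _ A

end FunctionalCalculus

lemma fc_ofReal (f : ℝ → ℝ) (A : H →L[ℂ] H) : fc (fun x => (f x : ℂ)) A = cfc f A := by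
  simp [fc]

section Operators

variable (G : H →L[ℂ] H) (t : ℝ)

@[simp] lemma Vop_apply_fst (w : WithLp 2 (H × H)) :
    (Vop G t w).fst = (t : ℂ) • w.fst + G w.snd := rfl

@[simp] lemma Vop_apply_snd (w : WithLp 2 (H × H)) :
    (Vop G t w).snd = adjoint G w.fst - (t : ℂ) • w.snd := rfl

@[simp] lemma LamOp_apply_fst (w : WithLp 2 (H × H)) :
    (LamOp G t w).fst = cfc (fun x : ℝ => Real.sqrt (t ^ 2 + x)) (G * adjoint G) w.fst := rfl

@[simp] lemma LamOp_apply_snd (w : WithLp 2 (H × H)) :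
    (LamOp G t w).snd = cfc (fun x : ℝ => Real.sqrt (t ^ 2 + x)) (adjoint G * G) w.snd := rfl

lemma isSelfAdjoint_Vop : IsSelfAdjoint (Vop G t) := by
  rw [ContinuousLinearMap.isSelfAdjoint_iff_isSymmetric]
  intro v w
  simp only [ContinuousLinearMap.coe_coe, WithLp.prod_inner_apply]
  change inner ℂ (Vop G t v).fst w.fst + inner ℂ (Vop G t v).snd w.snd
    = inner ℂ v.fst (Vop G t w).fst + inner ℂ v.snd (Vop G t w).snd
  simp only [Vop_apply_fst, Vop_apply_snd, inner_add_left, inner_add_right, inner_sub_left,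
    inner_sub_right, inner_smul_left, inner_smul_right, adjoint_inner_left,
    adjoint_inner_right, Complex.conj_ofReal]
  ring

lemma isSelfAdjoint_LamInv : IsSelfAdjoint (LamInv G t) := by
  rw [ContinuousLinearMap.isSelfAdjoint_iff_isSymmetric]
  intro v w
  simp only [ContinuousLinearMap.coe_coe, WithLp.prod_inner_apply]
  exact congrArg₂ (· + ·)
    (isSelfAdjoint_iff_isSymmetric.1 (cfc_predicate _ (G * adjoint G)) v.fst w.fst)
    (isSelfAdjoint_iff_isSymmetric.1 (cfc_predicate _ (adjoint G * G)) v.snd w.snd)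

variable {G}

lemma LamOp_mul_LamInv (hu : IsUnit G) : LamOp G t * LamInv G t = 1 := by
  have hu' : IsUnit (adjoint G) := hu.star
  exact ext_fst_snd
    (fun w => DFunLike.congr_fun (cfc_sqrt_sq_add_mul_cfc_inv (t := t)
      (mul_star_self_nonneg G) (hu.mul hu')) w.fst)
    (fun w => DFunLike.congr_fun (cfc_sqrt_sq_add_mul_cfc_inv (t := t)
      (star_mul_self_nonneg G) (hu'.mul hu)) w.snd)

lemma LamInv_mul_LamOp (hu : IsUnit G) : LamInv G t * LamOp G t = 1 := by
  have hu' : IsUnit (adjoint G) := hu.star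
  exact ext_fst_snd
    (fun w => DFunLike.congr_fun (cfc_inv_mul_cfc_sqrt_sq_add (t := t)
      (mul_star_self_nonneg G) (hu.mul hu')) w.fst)
    (fun w => DFunLike.congr_fun (cfc_inv_mul_cfc_sqrt_sq_add (t := t)
      (star_mul_self_nonneg G) (hu'.mul hu)) w.snd)

lemma Vop_mul_self (hu : IsUnit G) : Vop G t * Vop G t = LamOp G t * LamOp G t := by
  have hu' : IsUnit (adjoint G) := hu.star
  refine ext_fst_snd (fun w => ?_) (fun w => ?_)
  · have h := DFunLike.congr_fun (cfc_sqrt_sq_add_mul_self (t := t)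
      (mul_star_self_nonneg G) (hu.mul hu')) w.fst
    refine Eq.trans ?_ h.symm
    change (t : ℂ) • ((t : ℂ) • w.fst + G w.snd) + G (adjoint G w.fst - (t : ℂ) • w.snd)
      = (t : ℂ) ^ 2 • w.fst + G (adjoint G w.fst)
    rw [map_sub, map_smul]
    module
  · have h := DFunLike.congr_fun (cfc_sqrt_sq_add_mul_self (t := t)
      (star_mul_self_nonneg G) (hu'.mul hu)) w.snd
    refine Eq.trans ?_ h.symm
    change adjoint G ((t : ℂ) • w.fst + G w.snd) - (t : ℂ) • (adjoint G w.fst - (t : ℂ) • w.snd)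
      = (t : ℂ) ^ 2 • w.snd + adjoint G (G w.snd)
    rw [map_add, map_smul]
    module

lemma LamOp_commute_Vop (hG : CommHyp G) : Commute (LamOp G t) (Vop G t) := by
  obtain ⟨h₁, h₂⟩ := hG (fun x => (Real.sqrt (t ^ 2 + x) : ℂ))
    (Complex.continuous_ofReal.comp (continuous_sqrt_sq_add t))
  rw [fc_ofReal, fc_ofReal] at h₁ h₂
  refine ext_fst_snd (fun w => ?_) (fun w => ?_)
  · have h := DFunLike.congr_fun h₁ w.snd
    simp only [comp_apply] at h
    simp [h]
  · have h := DFunLike.congr_fun h₂ w.fst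
    simp only [comp_apply] at h
    simp [h]

end Operators

/-- `Π_t^±` are orthogonal projections diagonalizing `V(t)`
(properties (1)–(4) of Section 3.2). -/
theorem stmt_10 (G : H →L[ℂ] H) (hG : CommHyp G) (hGu : IsUnit G) (t : ℝ) :
    (ContinuousLinearMap.adjoint (PiP G t) = PiP G t ∧
     ContinuousLinearMap.adjoint (PiM G t) = PiM G t) ∧
    (PiP G t ∘L PiP G t = PiP G t ∧ PiM G t ∘L PiM G t = PiM G t) ∧
    (PiP G t ∘L PiM G t = 0 ∧ PiM G t ∘L PiP G t = 0) ∧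
    (PiP G t + PiM G t = 1) ∧
    (Vop G t ∘L PiP G t = PiP G t ∘L Vop G t ∧
     PiP G t ∘L Vop G t = LamOp G t ∘L PiP G t ∧
     LamOp G t ∘L PiP G t = PiP G t ∘L LamOp G t ∧
     Vop G t ∘L PiM G t = PiM G t ∘L Vop G t ∧
     PiM G t ∘L Vop G t = -(LamOp G t ∘L PiM G t) ∧
     LamOp G t ∘L PiM G t = PiM G t ∘L LamOp G t) := by
  set V := Vop G t
  set L := LamOp G t
  set J := LamInv G t
  have hLJ : L * J = 1 := LamOp_mul_LamInv t hGu
  have hJL : J * L = 1 := LamInv_mul_LamOp t hGu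
  have hVV : V * V = L * L := Vop_mul_self t hGu
  have hLV : L * V = V * L := LamOp_commute_Vop t hG
  have hJV : J * V = V * J := by
    calc J * V = J * (V * L) * J := by simp only [mul_assoc, hLJ, mul_one]
      _ = V * J := by rw [← hLV, ← mul_assoc, hJL, one_mul]
  have hVs : adjoint V = V := isSelfAdjoint_Vop G t
  have hJs : adjoint J = J := isSelfAdjoint_LamInv G t
  have hP : PiP G t = (2 : ℂ)⁻¹ • (1 + J * V) := rfl
  have hM : PiM G t = (2 : ℂ)⁻¹ • (1 - J * V) := rfl
  have hSs : star (J * V) = J * V := by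
    rw [star_mul, star_eq_adjoint, star_eq_adjoint, hVs, hJs, hJV]
  have hSS : J * V * (J * V) = 1 := by
    calc J * V * (J * V) = J * V * (V * J) := congrArg (J * V * ·) hJV
      _ = J * (V * V) * J := by simp only [mul_assoc]
      _ = 1 := by rw [hVV, ← mul_assoc, hJL, one_mul, hLJ]
  have hSV : J * V * V = L := by rw [mul_assoc, hVV, ← mul_assoc, hJL, one_mul]
  have hVS : V * (J * V) = L := by rw [← mul_assoc, ← hJV, hSV]
  have hLS : L * (J * V) = V := by rw [← mul_assoc, hLJ, one_mul]
  have hSL : J * V * L = V := by rw [mul_assoc, ← hLV, ← mul_assoc, hJL, one_mul]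
  simp only [← star_eq_adjoint, ← mul_def, hP, hM]
  refine ⟨⟨?_, ?_⟩, ⟨?_, ?_⟩, ⟨?_, ?_⟩, by module, ?_, ?_, ?_, ?_, ?_, ?_⟩ <;>
    simp only [star_smul, star_add, star_sub, star_one, hSs, star_inv₀, star_ofNat, smul_mul_assoc,
      mul_smul_comm, add_mul, mul_add, sub_mul, mul_sub, one_mul, mul_one, hSS, hSV, hVS, hLS,
      hSL] <;> module

end
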